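/- arXiv:math/0702207 — 2 statements merged into one kernel-verified Lean document; each statement's English description precedes it below -/
import Mathlib

section
/- Every finite metric space X embeds isometrically into a finite metric space Z such that every partial isometry of X extends to a self-isometry of Z. Precisely: for every finite metric space X there exist a finite metric space Z and an isometric embedding e : X → Z such that for every subset A ⊆ X and every distance-preserving map p : A → X, there exists a distance-preserving bijection j : Z → Z with j (e a) = e (p a) for all a ∈ A. -/
open scoped ENNReal
open Finset

/-- `w` is a weighting (`⊤` = non-edge) on `V`, `e` a copy of `X` in `V`, and every partial isometry
of `X` extends to a `w`-preserving permutation of `V`. -/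
structure SVGood (X : Type) [MetricSpace X] (V : Type) (w : V → V → ℝ≥0∞) (e : X → V)
    (m : ℝ≥0∞) : Prop where
  symm : ∀ x y, w x y = w y x
  irr : ∀ x, w x x = ⊤
  low : ∀ x y, m ≤ w x y
  inj : Function.Injective e
  emb : ∀ a b, a ≠ b → w (e a) (e b) = edist a b
  ext : ∀ (A : Set X) (p : X → X), (∀ a ∈ A, ∀ b ∈ A, dist (p a) (p b) = dist a b) →
    ∃ g : V ≃ V, (∀ x y, w (g x) (g y) = w x y) ∧ ∀ a ∈ A, g (e a) = e (p a)

/-- No non-metric closed walk with at most `n + 1` edges. -/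
def SVNoBad {V : Type} (w : V → V → ℝ≥0∞) (n : ℕ) : Prop :=
  ∀ k ≤ n, ∀ x : ℕ → V, w (x 0) (x k) ≠ ⊤ →
    w (x 0) (x k) ≤ ∑ i ∈ range k, w (x i) (x (i + 1))

/-- `z` lies on a non-metric closed walk with long edge `u v`. -/
def SVOnBad {V : Type} (w : V → V → ℝ≥0∞) (n : ℕ) (u v z : V) : Prop :=
  ∃ x : ℕ → V, x 0 = u ∧ x (n + 1) = v ∧ w u v ≠ ⊤ ∧
    (∑ i ∈ range (n + 1), w (x i) (x (i + 1))) < w u v ∧ ∃ i ≤ n + 1, x i = z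

lemma SVOnBad.map {V : Type} {w : V → V → ℝ≥0∞} {n : ℕ} (g : V ≃ V)
    (hg : ∀ x y, w (g x) (g y) = w x y) {u v z : V} (h : SVOnBad w n u v z) :
    SVOnBad w n (g u) (g v) (g z) := by
  obtain ⟨x, h0, h1, h2, h3, i, hi, h4⟩ := h
  refine ⟨fun i => g (x i), by simp [h0], by simp [h1], by rwa [hg], ?_, i, hi, by simp [h4]⟩
  simpa [hg] using h3

lemma SVOnBad.map_iff {V : Type} {w : V → V → ℝ≥0∞} {n : ℕ} (g : V ≃ V)
    (hg : ∀ x y, w (g x) (g y) = w x y) {u v z : V} :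
    SVOnBad w n (g u) (g v) (g z) ↔ SVOnBad w n u v z := by
  refine ⟨fun h => ?_, fun h => h.map g hg⟩
  have := h.map g.symm (fun x y => by rw [← hg]; simp)
  simpa using this

/-- Key fact: a metric copy of `X` containing the long edge meets the walk only in that edge. -/
lemma SVOnBad.key {X : Type} [MetricSpace X] {V : Type} {w : V → V → ℝ≥0∞} {e : X → V}
    {m : ℝ≥0∞} (H : SVGood X V w e m) {n : ℕ} (hn : SVNoBad w n) {a c b : X}
    (h : SVOnBad w n (e a) (e c) (e b)) : b = a ∨ b = c := by
  obtain ⟨x, h0, h1, h2, h3, i, hi, h4⟩ := h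
  by_contra hcon
  push Not at hcon
  obtain ⟨hba, hbc⟩ := hcon
  have hi0 : i ≠ 0 := by
    rintro rfl
    exact hba (H.inj (h4.symm.trans h0))
  have hin : i ≠ n + 1 := by
    rintro rfl
    exact hbc (H.inj (h4.symm.trans h1))
  have hac : a ≠ c := by
    rintro rfl
    exact h2 (H.irr _)
  have k1 := hn i (by omega) x (by rw [h0, h4, H.emb _ _ hba.symm]; exact edist_ne_top _ _)
  obtain ⟨j, hj⟩ : ∃ j, n + 1 = i + j := ⟨n + 1 - i, by omega⟩
  have k2 := hn j (by omega) (fun t => x (i + t)) (by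
    simp only [add_zero, ← hj]; rw [h1, h4, H.emb _ _ hbc]; exact edist_ne_top _ _)
  simp only [add_zero, ← hj] at k2
  rw [h0, h4, H.emb _ _ hba.symm] at k1
  rw [h1, h4, H.emb _ _ hbc] at k2
  rw [hj, sum_range_add, H.emb _ _ hac] at h3
  have := (edist_triangle a b c).trans (add_le_add k1 k2)
  simp only [add_assoc] at *
  exact absurd h3 (not_lt.mpr this)

lemma SVx1 {a b t : Prop} (h : Xor a t ↔ Xor b t) : a ↔ b := by
  by_cases a <;> by_cases b <;> by_cases t <;> simp_all [Xor]

lemma SVx2 {a b t : Prop} : Xor (Xor a t) (Xor b t) ↔ Xor a b := by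
  by_cases a <;> by_cases b <;> by_cases t <;> simp_all [Xor]

lemma SVx3 {a b a' b' : Prop} (h : Xor a' b' ↔ Xor a b) (h2 : Xor b' b) : Xor a' a := by
  by_cases a <;> by_cases b <;> by_cases a' <;> by_cases b' <;> simp_all [Xor]

lemma SVx4 {a b : Prop} : Xor a (Xor b a) ↔ b := by
  by_cases a <;> by_cases b <;> simp_all [Xor]

/-- The edge condition of the double cover. -/
def SVOk {V : Type} (w : V → V → ℝ≥0∞) (n : ℕ) (s t : V × (V → V → Prop)) : Prop :=
  ∀ u v, SVOnBad w n u v s.1 → SVOnBad w n u v t.1 →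
    (Xor (s.2 u v) (t.2 u v) ↔ ((s.1 = u ∧ t.1 = v) ∨ (s.1 = v ∧ t.1 = u)))

lemma SVOk.comm {V : Type} {w : V → V → ℝ≥0∞} {n : ℕ} {s t : V × (V → V → Prop)}
    (h : SVOk w n s t) : SVOk w n t s := by
  intro u v h1 h2
  have := h u v h2 h1
  rw [xor_comm, this, or_comm, and_comm, and_comm (a := s.1 = u)]

open Classical in
/-- The weights of the double cover. -/
noncomputable def SVCov {V : Type} (w : V → V → ℝ≥0∞) (n : ℕ) (s t : V × (V → V → Prop)) : ℝ≥0∞ :=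
  if SVOk w n s t then w s.1 t.1 else ⊤

lemma SVCov.le {V : Type} {w : V → V → ℝ≥0∞} {n : ℕ} (s t : V × (V → V → Prop)) :
    w s.1 t.1 ≤ SVCov w n s t := by
  unfold SVCov
  split_ifs <;> simp

lemma SVCov.of_ne {V : Type} {w : V → V → ℝ≥0∞} {n : ℕ} {s t : V × (V → V → Prop)}
    (h : SVCov w n s t ≠ ⊤) : SVOk w n s t ∧ SVCov w n s t = w s.1 t.1 := by
  unfold SVCov at *
  split_ifs at * with h1
  · exact ⟨h1, rfl⟩
  · exact absurd rfl h

lemma SVCov.noBad {V : Type} {w : V → V → ℝ≥0∞} {n : ℕ} 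
    (hsymm : ∀ x y, w x y = w y x) (hn : SVNoBad w n) :
    SVNoBad (SVCov w n) (n + 1) := by
  intro k hk x hx
  obtain ⟨hok, heq⟩ := SVCov.of_ne hx
  have hle : (∑ i ∈ range k, w (x i).1 (x (i + 1)).1) ≤
      ∑ i ∈ range k, SVCov w n (x i) (x (i + 1)) :=
    sum_le_sum fun i _ => SVCov.le _ _
  rw [heq] at hx ⊢
  rcases Nat.lt_or_ge n k with hk' | hk'
  swap
  · exact (hn k hk' (fun i => (x i).1) hx).trans hle
  obtain rfl : k = n + 1 := by omega
  by_contra hbad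
  push Not at hbad
  have hmem : ∀ i ≤ n + 1, SVOnBad w n (x 0).1 (x (n + 1)).1 (x i).1 := fun i hi =>
    ⟨fun i => (x i).1, rfl, rfl, hx, hle.trans_lt hbad, i, hi, rfl⟩
  have hstep : ∀ i ≤ n + 1, ((x i).2 (x 0).1 (x (n + 1)).1 ↔ (x 0).2 (x 0).1 (x (n + 1)).1) := by
    intro i
    induction i with
    | zero => intro _; rfl
    | succ i ih =>
      intro hi
      rw [← ih (by omega)]
      have hlt : SVCov w n (x i) (x (i + 1)) < w (x 0).1 (x (n + 1)).1 :=
        (single_le_sum (f := fun i => SVCov w n (x i) (x (i + 1))) (fun _ _ => zero_le)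
          (mem_range.mpr hi)).trans_lt hbad
      obtain ⟨ok, heq'⟩ := SVCov.of_ne (hlt.trans_le le_top).ne
      rw [heq'] at hlt
      have := ok _ _ (hmem i (by omega)) (hmem (i + 1) hi)
      have hno : ¬ (((x i).1 = (x 0).1 ∧ (x (i + 1)).1 = (x (n + 1)).1) ∨
          ((x i).1 = (x (n + 1)).1 ∧ (x (i + 1)).1 = (x 0).1)) := by
        rintro (⟨h1, h2⟩ | ⟨h1, h2⟩)
        · rw [h1, h2] at hlt; exact lt_irrefl _ hlt
        · rw [h1, h2, hsymm] at hlt; exact lt_irrefl _ hlt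
      have h2 := mt this.1 hno
      unfold Xor at h2
      tauto
  have h1 := hstep (n + 1) le_rfl
  have h2 := (hok _ _ (hmem 0 (by omega)) (hmem _ le_rfl)).2 (Or.inl ⟨rfl, rfl⟩)
  unfold Xor at h2
  tauto

lemma SVGood.step {X : Type} [MetricSpace X] {V : Type} [Finite V] {w : V → V → ℝ≥0∞} {e : X → V}
    {m : ℝ≥0∞} (H : SVGood X V w e m) {n : ℕ} (hn : SVNoBad w n) :
    ∃ e' : X → V × (V → V → Prop), SVGood X (V × (V → V → Prop)) (SVCov w n) e' m := by
  let χ : X → V → V → Prop := fun a u v => e a = u ∧ SVOnBad w n u v (e a) ∧ ∃ c, e c = v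
  have hχ : ∀ a b, a ≠ b → SVOk w n (e a, χ a) (e b, χ b) := by
    intro a b hab u v ha hb
    simp only at ha hb
    have hne : e a ≠ e b := fun h => hab (H.inj h)
    by_cases huv : (∃ c, e c = u) ∧ ∃ c, e c = v
    · obtain ⟨⟨c, rfl⟩, d, rfl⟩ := huv
      have hcd : c ≠ d := by
        rintro rfl
        obtain ⟨_, _, _, h, _⟩ := ha
        exact h (H.irr _)
      have h1 := SVOnBad.key H hn ha
      have h2 := SVOnBad.key H hn hb
      have hcd' : e c ≠ e d := fun h => hcd (H.inj h)
      simp only [χ, Xor, H.inj.eq_iff, ha, hb]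
      rcases h1 with rfl | rfl <;> rcases h2 with rfl | rfl <;> simp_all [eq_comm]
    · simp only [χ, Xor]
      constructor
      · rintro (⟨⟨h1, _, h2⟩, _⟩ | ⟨⟨h1, _, h2⟩, _⟩)
        · exact absurd ⟨⟨_, h1⟩, h2⟩ huv
        · exact absurd ⟨⟨_, h1⟩, h2⟩ huv
      · rintro (⟨h1, h2⟩ | ⟨h1, h2⟩)
        · exact absurd ⟨⟨_, h1⟩, ⟨_, h2⟩⟩ huv
        · exact absurd ⟨⟨_, h2⟩, ⟨_, h1⟩⟩ huv
  refine ⟨fun a => (e a, χ a), ?_, ?_, ?_, ?_, ?_, ?_⟩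
  · intro s t
    have : SVOk w n s t ↔ SVOk w n t s := ⟨SVOk.comm, SVOk.comm⟩
    unfold SVCov
    by_cases h : SVOk w n s t
    · rw [if_pos h, if_pos (this.1 h), H.symm]
    · rw [if_neg h, if_neg (mt this.2 h)]
  · intro s
    have := SVCov.le (w := w) (n := n) s s
    rw [H.irr] at this
    exact top_le_iff.mp this
  · intro s t
    exact (H.low _ _).trans (SVCov.le _ _)
  · intro a b h
    exact H.inj (Prod.ext_iff.mp h).1
  · intro a b hab
    simp only [SVCov, hχ a b hab, if_true]
    exact H.emb _ _ hab
  · intro A p hp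
    obtain ⟨g, hg, hgA⟩ := H.ext A p hp
    let T : V → V → Prop := fun u v => ∃ a ∈ A, SVOnBad w n u v (e a) ∧
      Xor (χ (p a) (g u) (g v)) (χ a u v)
    let f : V × (V → V → Prop) → V × (V → V → Prop) := fun s =>
      (g s.1, fun u v => Xor (s.2 (g.symm u) (g.symm v))
        (T (g.symm u) (g.symm v) ∧ SVOnBad w n (g.symm u) (g.symm v) s.1))
    have hf : Function.Injective f := by
      rintro ⟨x, α⟩ ⟨y, β⟩ h
      simp only [f, Prod.mk.injEq] at h
      obtain ⟨h1, h2⟩ := h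
      obtain rfl := g.injective h1
      congr 1
      funext u v
      have := congrFun (congrFun h2 (g u)) (g v)
      simp only [Equiv.symm_apply_apply, eq_iff_iff] at this
      apply propext
      exact SVx1 this
    have hfok : ∀ s t, SVOk w n (f s) (f t) ↔ SVOk w n s t := by
      intro s t
      unfold SVOk
      rw [← g.forall_congr_right]
      refine forall_congr' fun u => ?_
      rw [← g.forall_congr_right]
      refine forall_congr' fun v => ?_
      simp only [f, SVOnBad.map_iff g hg, Equiv.symm_apply_apply, g.injective.eq_iff]
      refine imp_congr_right fun h1 => imp_congr_right fun h2 => ?_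
      simp only [h1, h2, and_true]
      have : Xor (Xor (s.2 u v) (T u v)) (Xor (t.2 u v) (T u v)) ↔
          Xor (s.2 u v) (t.2 u v) := by
        exact SVx2
      rw [this]
    refine ⟨Equiv.ofBijective f (Finite.injective_iff_bijective.mp hf), ?_, ?_⟩
    · intro s t
      change SVCov w n (f s) (f t) = SVCov w n s t
      have h1 : w (f s).1 (f t).1 = w s.1 t.1 := hg _ _
      unfold SVCov
      by_cases h : SVOk w n s t
      · rw [if_pos h, if_pos ((hfok s t).2 h), h1]
      · rw [if_neg h, if_neg (mt (hfok s t).1 h)]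
    · intro a ha
      simp only [Equiv.ofBijective_apply, f, Prod.mk.injEq]
      refine ⟨hgA a ha, ?_⟩
      funext u' v'
      obtain ⟨u, rfl⟩ := g.surjective u'
      obtain ⟨v, rfl⟩ := g.surjective v'
      simp only [Equiv.symm_apply_apply, eq_iff_iff]
      have hiff : SVOnBad w n (g u) (g v) (e (p a)) ↔ SVOnBad w n u v (e a) := by
        rw [← hgA a ha, SVOnBad.map_iff g hg]
      by_cases hon : SVOnBad w n u v (e a)
      swap
      · have h1 : ¬ χ a u v := fun h => hon h.2.1
        have h2 : ¬ χ (p a) (g u) (g v) := fun h => hon (hiff.1 h.2.1)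
        simp [h1, h2, hon, Xor]
      · have hT : T u v ↔ Xor (χ (p a) (g u) (g v)) (χ a u v) := by
          refine ⟨?_, fun h => ⟨a, ha, hon, h⟩⟩
          rintro ⟨b, hb, hbon, hx⟩
          by_cases hab : a = b
          · rwa [hab]
          have hpab : p a ≠ p b := by
            intro h
            have := hp a ha b hb
            rw [h, dist_self] at this
            exact hab (dist_eq_zero.mp this.symm)
          have e1 := hχ a b hab u v hon hbon
          have e2 := hχ (p a) (p b) hpab (g u) (g v) (hiff.2 hon)
            (by rw [← hgA b hb, SVOnBad.map_iff g hg]; exact hbon)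
          simp only [← hgA a ha, ← hgA b hb, g.injective.eq_iff] at e2
          simp only at e1
          rw [← e1] at e2
          exact SVx3 e2 hx
        simp only [hT, hon, and_true]
        exact SVx4

lemma SV_perm {X : Type} [MetricSpace X] [Finite X] (A : Set X) (p : X → X)
    (hp : ∀ a ∈ A, ∀ b ∈ A, dist (p a) (p b) = dist a b) :
    ∃ q : X ≃ X, ∀ a ∈ A, q a = p a := by
  classical
  have hinj : Set.InjOn p A := by
    intro a ha b hb h
    have := hp a ha b hb
    rw [h, dist_self] at this
    exact dist_eq_zero.mp this.symm
  let E : {x // x ∈ A} ≃ {x // x ∈ p '' A} := Equiv.Set.imageOfInjOn p A hinj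
  refine ⟨E.extendSubtype, fun a ha => ?_⟩
  rw [Equiv.extendSubtype_apply_of_mem E a ha]
  rfl

lemma SVGood.base (X : Type) [MetricSpace X] [Finite X] (m : ℝ≥0∞)
    (hm : ∀ a b : X, a ≠ b → m ≤ edist a b) :
    ∃ (V : Type) (_ : Finite V) (w : V → V → ℝ≥0∞) (e : X → V), SVGood X V w e m := by
  classical
  let S := Set.range (fun q : X × X => dist q.1 q.2)
  let G := S → ZMod 3
  have : Finite S := Set.finite_range _
  let c : X → X → (S → ZMod 3) := fun a b => Pi.single ⟨dist a b, (a, b), rfl⟩ 2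
  have hc : ∀ a b a' b', dist a b = dist a' b' → c a b = c a' b' := by
    intro a b a' b' h
    simp only [c, h]
  have hcs : ∀ a b, c a b = c b a := fun a b => hc _ _ _ _ (dist_comm _ _)
  have hc2 : ∀ a b a' b', c a b + c a b = c a' b' + c a' b' → dist a b = dist a' b' := by
    intro a b a' b' h
    by_contra hne
    have := congrFun h ⟨dist a b, (a, b), rfl⟩
    have hne' : (⟨dist a b, (a, b), rfl⟩ : S) ≠ ⟨dist a' b', (a', b'), rfl⟩ :=
      fun h => hne (congrArg Subtype.val h)
    simp only [c] at this
    rw [Pi.add_apply, Pi.add_apply, Pi.single_eq_same, Pi.single_eq_of_ne hne'] at this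
    exact absurd this (by decide)
  let l : G → ℝ≥0∞ := fun g => ⨅ q : X × X, ⨅ _ : q.1 ≠ q.2 ∧ g = c q.1 q.2 + c q.1 q.2,
    edist q.1 q.2
  have hl : ∀ a b, a ≠ b → l (c a b + c a b) = edist a b := by
    intro a b hab
    apply le_antisymm
    · exact iInf₂_le (a, b) ⟨hab, rfl⟩
    · refine le_iInf₂ fun q hq => ?_
      have := hc2 _ _ _ _ hq.2
      simp only [edist_dist, this]
      exact le_rfl
  have hlm : ∀ g, m ≤ l g := fun g => le_iInf₂ fun q hq => hm _ _ hq.1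
  let w : X × (X → G) → X × (X → G) → ℝ≥0∞ := fun s t =>
    if s.1 = t.1 then ⊤ else l (s.2 t.1 + t.2 s.1)
  refine ⟨X × (X → G), inferInstance, w, fun a => (a, c a), ?_, ?_, ?_, ?_, ?_, ?_⟩
  · intro s t
    simp only [w, eq_comm, add_comm]
  · intro s
    simp [w]
  · intro s t
    simp only [w]
    split_ifs
    · exact le_top
    · exact hlm _
  · intro a b h
    exact (Prod.ext_iff.mp h).1
  · intro a b hab
    simp only [w, hab, if_false]
    rw [hcs b a, hl a b hab]
  · intro A p hp
    obtain ⟨q, hq⟩ := SV_perm A p hp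
    let τ : X → X → G := fun a b =>
      if a ∈ A ∧ b ∉ A then c (q a) (q b) - c a b
      else if a ∉ A ∧ b ∈ A then c a b - c (q a) (q b) else 0
    have hτ : ∀ a b, τ a b + τ b a = 0 := by
      intro a b
      simp only [τ, hcs b a, hcs (q b) (q a)]
      by_cases ha : a ∈ A <;> by_cases hb : b ∈ A <;> simp [ha, hb]
    have hτA : ∀ a ∈ A, ∀ b, c a b + τ a b = c (q a) (q b) := by
      intro a ha b
      by_cases hb : b ∈ A
      · simp only [τ, ha, hb]
        simp
        apply hc
        rw [hq a ha, hq b hb, hp a ha b hb]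
      · simp [τ, ha, hb]
    let f : X × (X → G) → X × (X → G) := fun s =>
      (q s.1, fun y => s.2 (q.symm y) + τ s.1 (q.symm y))
    have hf : Function.Injective f := by
      rintro ⟨x, α⟩ ⟨y, β⟩ h
      simp only [f, Prod.mk.injEq] at h
      obtain ⟨h1, h2⟩ := h
      obtain rfl := q.injective h1
      congr 1
      funext u
      simpa using congrFun h2 (q u)
    refine ⟨Equiv.ofBijective f (Finite.injective_iff_bijective.mp hf), ?_, ?_⟩
    · intro s t
      simp only [Equiv.ofBijective_apply, w, f, q.injective.eq_iff, Equiv.symm_apply_apply]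
      have : s.2 t.1 + τ s.1 t.1 + (t.2 s.1 + τ t.1 s.1) = s.2 t.1 + t.2 s.1 := by
        rw [add_add_add_comm, hτ, add_zero]
      rw [this]
    · intro a ha
      simp only [Equiv.ofBijective_apply, f, Prod.mk.injEq]
      refine ⟨hq a ha, ?_⟩
      funext y
      obtain ⟨b, rfl⟩ := q.surjective y
      simp only [Equiv.symm_apply_apply]
      rw [hτA a ha b, hq a ha]

lemma SVGood.exists (X : Type) [MetricSpace X] [Finite X] (m : ℝ≥0∞)
    (hm : ∀ a b : X, a ≠ b → m ≤ edist a b) (n : ℕ) :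
    ∃ (V : Type) (_ : Finite V) (w : V → V → ℝ≥0∞) (e : X → V),
      SVGood X V w e m ∧ SVNoBad w n := by
  induction n with
  | zero =>
    obtain ⟨V, hV, w, e, H⟩ := SVGood.base X m hm
    refine ⟨V, hV, w, e, H, ?_⟩
    intro k hk x hx
    obtain rfl : k = 0 := by omega
    exact absurd (H.irr _) hx
  | succ n ih =>
    obtain ⟨V, hV, w, e, H, hn⟩ := ih
    obtain ⟨e', H'⟩ := H.step hn
    exact ⟨_, inferInstance, _, e', H', SVCov.noBad H.symm hn⟩

/-- Path distance. -/
noncomputable def SVD {V : Type} (w : V → V → ℝ≥0∞) (u v : V) : ℝ≥0∞ :=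
  ⨅ q : ℕ × (ℕ → V), ⨅ _ : q.2 0 = u ∧ q.2 q.1 = v, ∑ i ∈ range q.1, w (q.2 i) (q.2 (i + 1))

lemma SVD_self {V : Type} (w : V → V → ℝ≥0∞) (u : V) : SVD w u u = 0 := by
  apply le_antisymm _ zero_le
  refine (iInf₂_le (0, fun _ => u) ⟨rfl, rfl⟩).trans ?_
  simp

lemma SVD_le {V : Type} (w : V → V → ℝ≥0∞) (u v : V) : SVD w u v ≤ w u v := by
  refine (iInf₂_le (1, fun i => if i = 0 then u else v) ⟨by simp, by simp⟩).trans ?_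
  simp

lemma SVD_comm_le {V : Type} {w : V → V → ℝ≥0∞} (hw : ∀ x y, w x y = w y x) (u v : V) :
    SVD w u v ≤ SVD w v u := by
  refine le_iInf₂ fun q hq => ?_
  refine (iInf₂_le (q.1, fun i => q.2 (q.1 - i)) ⟨by simpa using hq.2, by simpa using hq.1⟩).trans ?_
  rw [← sum_range_reflect]
  apply sum_le_sum
  intro i hi
  simp only [mem_range] at hi
  simp only
  rw [hw]
  have h1 : q.1 - (q.1 - 1 - i + 1) = i := by omega
  have h2 : q.1 - (q.1 - 1 - i) = i + 1 := by omega
  rw [h1, h2]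

lemma SVD_triangle {V : Type} (w : V → V → ℝ≥0∞) (u v z : V) :
    SVD w u z ≤ SVD w u v + SVD w v z := by
  have key : ∀ q r : ℕ × (ℕ → V), (q.2 0 = u ∧ q.2 q.1 = v) → (r.2 0 = v ∧ r.2 r.1 = z) →
      SVD w u z ≤ (∑ i ∈ range q.1, w (q.2 i) (q.2 (i + 1))) +
        ∑ i ∈ range r.1, w (r.2 i) (r.2 (i + 1)) := by
    rintro ⟨k, x⟩ ⟨l, y⟩ ⟨hx0, hx1⟩ ⟨hy0, hy1⟩
    simp only at *
    refine (iInf₂_le (k + l, fun i => if i ≤ k then x i else y (i - k)) ⟨by simpa using hx0, ?_⟩).trans ?_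
    swap
    · simp only
      split_ifs with h
      · obtain rfl : l = 0 := by omega
        rw [add_zero, hx1, ← hy1, hy0]
      · rw [Nat.add_sub_cancel_left, hy1]
    · simp only
      rw [sum_range_add]
      apply add_le_add
      · apply sum_le_sum
        intro i hi
        rw [mem_range] at hi
        rw [if_pos (by omega), if_pos (by omega)]
      · apply sum_le_sum
        intro i hi
        have h1 : k + i + 1 - k = i + 1 := by omega
        rw [if_neg (by omega : ¬ (k + i + 1 ≤ k)), h1]
        split_ifs with h
        · obtain rfl : i = 0 := by omega
          rw [add_zero, hx1, hy0]
        · rw [Nat.add_sub_cancel_left]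
  conv_rhs => unfold SVD
  simp only [ENNReal.iInf_add, ENNReal.add_iInf]
  exact le_iInf fun q => le_iInf fun hq => le_iInf fun r => le_iInf fun hr => key r q hr hq

lemma SVD_low {V : Type} {w : V → V → ℝ≥0∞} {m : ℝ≥0∞} (hm : ∀ x y, m ≤ w x y) {u v : V}
    (huv : u ≠ v) : m ≤ SVD w u v := by
  refine le_iInf₂ fun q hq => ?_
  have h0 : q.1 ≠ 0 := by
    intro h
    rw [h] at hq
    exact huv (hq.1.symm.trans hq.2)
  exact (hm _ _).trans (single_le_sum (f := fun i => w (q.2 i) (q.2 (i + 1)))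
    (fun _ _ => zero_le) (mem_range.mpr (Nat.pos_of_ne_zero h0)))

lemma SVD_map_le {V : Type} {w : V → V → ℝ≥0∞} (g : V ≃ V)
    (hg : ∀ x y, w (g x) (g y) = w x y) (u v : V) : SVD w (g u) (g v) ≤ SVD w u v := by
  refine le_iInf₂ fun q hq => ?_
  refine (iInf₂_le (q.1, fun i => g (q.2 i)) ⟨by simp [hq.1], by simp [hq.2]⟩).trans ?_
  simp [hg]

lemma SVD_map {V : Type} {w : V → V → ℝ≥0∞} (g : V ≃ V)
    (hg : ∀ x y, w (g x) (g y) = w x y) (u v : V) : SVD w (g u) (g v) = SVD w u v := by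
  apply le_antisymm (SVD_map_le g hg u v)
  have := SVD_map_le (w := w) g.symm (fun x y => by rw [← hg]; simp) (g u) (g v)
  simpa using this

lemma SV_const (X : Type) [MetricSpace X] [Finite X] :
    ∃ K : ℝ, 1 ≤ K ∧ (∀ a b : X, dist a b ≤ K) ∧ ∀ a b : X, a ≠ b → K⁻¹ ≤ dist a b := by
  obtain ⟨C, hC⟩ := (Set.finite_range (fun q : X × X => dist q.1 q.2)).bddAbove
  obtain ⟨C', hC'⟩ := (Set.finite_range (fun q : X × X => (dist q.1 q.2)⁻¹)).bddAbove
  refine ⟨max 1 (max C C'), le_max_left _ _, fun a b => ?_, fun a b hab => ?_⟩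
  · exact (hC ⟨(a, b), rfl⟩).trans ((le_max_left _ _).trans (le_max_right _ _))
  · have h1 : (dist a b)⁻¹ ≤ max 1 (max C C') :=
      (hC' ⟨(a, b), rfl⟩).trans ((le_max_right _ _).trans (le_max_right _ _))
    exact inv_le_of_inv_le₀ (dist_pos.mpr hab) h1

/-- **Solecki–Vershik theorem.** Every finite metric space `X` embeds isometrically into a
finite metric space `Z` such that every partial isometry of `X` extends to a self-isometry
of `Z`. -/
theorem solecki_vershik (X : Type) [MetricSpace X] [Finite X] :
    ∃ (Z : Type) (_ : MetricSpace Z) (_ : Finite Z) (e : X → Z),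
      Isometry e ∧
      ∀ (A : Set X) (p : X → X),
        (∀ a ∈ A, ∀ b ∈ A, dist (p a) (p b) = dist a b) →
        ∃ j : Z ≃ᵢ Z, ∀ a ∈ A, j (e a) = e (p a) := by
  obtain ⟨K, hK1, hKd, hKi⟩ := SV_const X
  have hK0 : 0 < K := by linarith
  obtain ⟨N, hN⟩ := exists_nat_ge (K * K)
  have hm : ∀ a b : X, a ≠ b → ENNReal.ofReal K⁻¹ ≤ edist a b := fun a b hab => by
    rw [edist_dist]
    exact ENNReal.ofReal_le_ofReal (hKi a b hab)
  have hM : ∀ a b : X, edist a b ≤ ENNReal.ofReal K := fun a b => by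
    rw [edist_dist]
    exact ENNReal.ofReal_le_ofReal (hKd a b)
  have hNm : ENNReal.ofReal K ≤ N * ENNReal.ofReal K⁻¹ := by
    rw [← ENNReal.ofReal_natCast, ← ENNReal.ofReal_mul (by positivity)]
    apply ENNReal.ofReal_le_ofReal
    rw [← div_eq_mul_inv, le_div_iff₀ hK0]
    exact hN
  have hm0 : 0 < ENNReal.ofReal K⁻¹ := ENNReal.ofReal_pos.mpr (by positivity)
  have hM0 : 0 < ENNReal.ofReal K := ENNReal.ofReal_pos.mpr hK0
  have hMt : ENNReal.ofReal K ≠ ⊤ := ENNReal.ofReal_ne_top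
  generalize ENNReal.ofReal K = M at *
  generalize ENNReal.ofReal K⁻¹ = m at *
  obtain ⟨V, hV, w, e, H, hn⟩ := SVGood.exists X m hm N
  have hfin : ∀ x y, min M (SVD w x y) ≠ ⊤ := fun x y => ((min_le_left _ _).trans_lt hMt.lt_top).ne
  let Z : MetricSpace V :=
    { dist := fun x y => (min M (SVD w x y)).toReal
      dist_self := fun x => by simp [SVD_self]
      dist_comm := fun x y => by
        rw [le_antisymm (SVD_comm_le H.symm x y) (SVD_comm_le H.symm y x)]
      dist_triangle := fun x y z => by
        rw [← ENNReal.toReal_add (hfin _ _) (hfin _ _)]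
        apply ENNReal.toReal_mono (ENNReal.add_ne_top.mpr ⟨hfin _ _, hfin _ _⟩)
        rcases le_total M (SVD w x y) with h1 | h1
        · rw [min_eq_left h1]
          exact (min_le_left _ _).trans le_self_add
        rcases le_total M (SVD w y z) with h2 | h2
        · rw [min_eq_left h2]
          exact (min_le_left _ _).trans le_add_self
        rw [min_eq_right h1, min_eq_right h2]
        exact (min_le_right _ _).trans (SVD_triangle w x y z)
      eq_of_dist_eq_zero := fun {x y} h => by
        by_contra hxy
        have h1 : 0 < min M (SVD w x y) := lt_min hM0 (hm0.trans_le (SVD_low H.low hxy))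
        exact (ENNReal.toReal_pos h1.ne' (hfin _ _)).ne' h }
  refine ⟨V, Z, hV, e, ?_, ?_⟩
  · refine Isometry.of_dist_eq fun a b => ?_
    change (min M (SVD w (e a) (e b))).toReal = dist a b
    by_cases hab : a = b
    · subst hab
      simp [SVD_self]
    have h1 : SVD w (e a) (e b) = edist a b := by
      apply le_antisymm
      · exact (SVD_le _ _ _).trans (H.emb a b hab).le
      · refine le_iInf₂ fun q hq => ?_
        rcases le_total q.1 N with hk | hk
        · have := hn q.1 hk q.2 (by rw [hq.1, hq.2, H.emb a b hab]; exact edist_ne_top _ _)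
          rwa [hq.1, hq.2, H.emb a b hab] at this
        · calc edist a b ≤ M := hM a b
            _ ≤ N * m := hNm
            _ ≤ q.1 * m := by gcongr
            _ = ∑ i ∈ range q.1, m := by simp
            _ ≤ _ := sum_le_sum fun i _ => H.low _ _
    rw [h1, min_eq_right (hM a b), edist_dist, ENNReal.toReal_ofReal dist_nonneg]
  · intro A p hp
    obtain ⟨g, hg, hgA⟩ := H.ext A p hp
    refine ⟨⟨g, Isometry.of_dist_eq fun x y => ?_⟩, hgA⟩
    change (min M (SVD w (g x) (g y))).toReal = (min M (SVD w x y)).toReal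
    rw [SVD_map g hg]
end

section
/- Let T ⊆ ℝ be a set closed under addition, and let S ⊆ T be a subset with 0 ∈ S that is convex in T (i.e., for all x, z ∈ S and y ∈ T, if x ≤ y ≤ z then y ∈ S). Then every finite metric space X all of whose distances lie in S embeds isometrically into a finite metric space Z all of whose distances lie in S, such that every partial isometry of X extends to a distance-preserving bijection of Z onto itself: for every subset A ⊆ X and every distance-preserving map p : A → X there is a distance-preserving bijection j : Z → Z with j (e a) = e (p a) for all a ∈ A, where e : X → Z is the isometric embedding. -/
open Classical in
/-- A partially labelled reflexive symmetric graph. -/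
structure PG (V : Type) where
  adj : V → V → Prop
  d : V → V → ℝ
  adj_refl : ∀ x, adj x x
  adj_symm : ∀ x y, adj x y → adj y x
  d_self : ∀ x, d x x = 0
  d_symm : ∀ x y, d x y = d y x

/-- A walk of length `n` whose endpoints are adjacent with too large a label. -/
def PG.Bad {V : Type} (P : PG V) (n : ℕ) (v : ℕ → V) : Prop :=
  (∀ i < n, P.adj (v i) (v (i + 1))) ∧ P.adj (v 0) (v n) ∧
    ∑ i ∈ Finset.range n, P.d (v i) (v (i + 1)) < P.d (v 0) (v n)

theorem PG.bad_congr {V : Type} (P : PG V) (n : ℕ) (v w : ℕ → V) (h : ∀ i ≤ n, v i = w i)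
    (hb : P.Bad n v) : P.Bad n w := by
  obtain ⟨h1, h2, h3⟩ := hb
  refine ⟨?_, ?_, ?_⟩
  · intro i hi
    rw [← h i hi.le, ← h (i + 1) hi]
    exact h1 i hi
  · rw [← h 0 (Nat.zero_le _), ← h n le_rfl]
    exact h2
  · rw [← h 0 (Nat.zero_le _), ← h n le_rfl]
    refine lt_of_eq_of_lt (Finset.sum_congr rfl ?_) h3
    intro i hi
    have hi := Finset.mem_range.1 hi
    rw [← h i hi.le, ← h (i + 1) hi]

theorem PG.bad_map {V W : Type} (P : PG V) (Q : PG W) (f : V → W)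
    (v : ℕ → V) (n : ℕ) (ha : ∀ x y, P.adj x y → Q.adj (f x) (f y))
    (hd : ∀ x y, P.adj x y → Q.d (f x) (f y) = P.d x y)
    (hb : P.Bad n v) : Q.Bad n (fun i => f (v i)) := by
  obtain ⟨h1, h2, h3⟩ := hb
  refine ⟨fun i hi => ha _ _ (h1 i hi), ha _ _ h2, ?_⟩
  rw [hd _ _ h2]
  refine lt_of_eq_of_lt (Finset.sum_congr rfl ?_) h3
  intro i hi
  exact hd _ _ (h1 i (Finset.mem_range.1 hi))

/-- All labels of edges between distinct points lie in `Δ`. -/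
def PG.Lab {V : Type} (P : PG V) (Δ : Set ℝ) : Prop :=
  ∀ x y, P.adj x y → x ≠ y → P.d x y ∈ Δ

theorem PG.nonneg {V : Type} (P : PG V) {Δ : Set ℝ} (hΔ : ∀ r ∈ Δ, 0 < r) (hP : P.Lab Δ)
    (x y : V) (h : P.adj x y) : 0 ≤ P.d x y := by
  by_cases hxy : x = y
  · subst hxy; rw [P.d_self]
  · exact (hΔ _ (hP x y h hxy)).le

theorem PG.bad_ends {V : Type} (P : PG V) {Δ : Set ℝ} (hΔ : ∀ r ∈ Δ, 0 < r) (hP : P.Lab Δ)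
    (n : ℕ) (v : ℕ → V) (hb : P.Bad n v) : v 0 ≠ v n := by
  intro h
  obtain ⟨h1, h2, h3⟩ := hb
  rw [← h, P.d_self] at h3
  have : 0 ≤ ∑ i ∈ Finset.range n, P.d (v i) (v (i + 1)) :=
    Finset.sum_nonneg fun i hi => P.nonneg hΔ hP _ _ (h1 i (Finset.mem_range.1 hi))
  linarith

theorem PG.bad_two {V : Type} (P : PG V) (n : ℕ) (v : ℕ → V) (hb : P.Bad n v) : 2 ≤ n := by
  obtain ⟨h1, h2, h3⟩ := hb
  by_contra hn
  have : n = 0 ∨ n = 1 := by omega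
  rcases this with rfl | rfl
  · simp [P.d_self] at h3
  · simp at h3

/-- Key lemma. -/
theorem PG.key {X V : Type} [MetricSpace X] (P : PG V) (e : X → V)
    (ha : ∀ x y, P.adj (e x) (e y)) (hd : ∀ x y, P.d (e x) (e y) = dist x y)
    (n : ℕ) (hn : ∀ m < n, ∀ v, ¬ P.Bad m v) (v : ℕ → V) (hb : P.Bad n v)
    (i : ℕ) (hi : 0 < i) (hin : i < n)
    (h0 : v 0 ∈ Set.range e) (h1 : v i ∈ Set.range e) (h2 : v n ∈ Set.range e) : False := by
  obtain ⟨b1, b2, b3⟩ := hb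
  obtain ⟨x, hx⟩ := h0
  obtain ⟨y, hy⟩ := h1
  obtain ⟨z, hz⟩ := h2
  have t : P.d (v 0) (v n) ≤ P.d (v 0) (v i) + P.d (v i) (v n) := by
    rw [← hx, ← hy, ← hz, hd, hd, hd]; exact dist_triangle _ _ _
  have s1 : P.d (v 0) (v i) ≤ ∑ k ∈ Finset.range i, P.d (v k) (v (k + 1)) := by
    by_contra hc
    refine hn i hin v ⟨fun k hk => b1 k (by omega), ?_, not_le.1 hc⟩
    rw [← hx, ← hy]; exact ha _ _
  have s2 : P.d (v i) (v n) ≤ ∑ k ∈ Finset.range (n - i), P.d (v (i + k)) (v (i + k + 1)) := by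
    by_contra hc
    refine hn (n - i) (by omega) (fun k => v (i + k)) ⟨fun k hk => b1 _ (by omega), ?_, ?_⟩
    · have : i + (n - i) = n := by omega
      simp only [this, add_zero]
      rw [← hy, ← hz]; exact ha _ _
    · have : i + (n - i) = n := by omega
      simp only [this, add_zero]
      exact not_le.1 hc
  have s3 := Finset.sum_range_add (fun k => P.d (v k) (v (k + 1))) i (n - i)
  have : i + (n - i) = n := by omega
  rw [this] at s3
  linarith

/-- `P` with `e` is an EPPA witness for `X`. -/
structure PG.Wit {X V : Type} [MetricSpace X] (P : PG V) (Δ : Set ℝ) (e : X → V) : Prop where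
  lab : P.Lab Δ
  adj : ∀ x y, P.adj (e x) (e y)
  dist : ∀ x y, P.d (e x) (e y) = dist x y
  ext : ∀ (A : Set X) (p : X → X),
    (∀ a ∈ A, ∀ b ∈ A, Dist.dist (p a) (p b) = Dist.dist a b) →
    ∃ j : V ≃ V, (∀ x y, P.adj (j x) (j y) ↔ P.adj x y) ∧ (∀ x y, P.d (j x) (j y) = P.d x y) ∧
      ∀ a ∈ A, j (e a) = e (p a)

def Stage (X : Type) [MetricSpace X] (Δ : Set ℝ) (n : ℕ) : Prop :=
  ∃ (V : Type) (_ : Finite V) (P : PG V) (e : X → V), P.Wit Δ e ∧ ∀ m < n, ∀ v, ¬ P.Bad m v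

/-- Extend an injective-on-`A` map to a permutation. -/
theorem exists_perm {X : Type} [Finite X] (A : Set X) (p : X → X) (hp : Set.InjOn p A) :
    ∃ g : X ≃ X, ∀ a ∈ A, g a = p a := by
  classical
  have := Fintype.ofFinite X
  let q : {x // x ∈ A} ≃ {x // x ∈ p '' A} := Equiv.Set.imageOfInjOn p A hp
  refine ⟨q.extendSubtype, fun a ha => ?_⟩
  rw [Equiv.extendSubtype_apply_of_mem _ _ ha]
  rfl

/-! ### The base step -/

open Classical in
noncomputable def encR (Δ : Set ℝ) (r : ℝ) : Δ → ZMod 3 := fun s => if s.1 = r then 1 else 0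

theorem exists_dec (Δ : Set ℝ) (hne : Δ.Nonempty) :
    ∃ dec : (Δ → ZMod 3) → ℝ, (∀ g, dec g ∈ Δ) ∧ ∀ r ∈ Δ, dec (encR Δ r) = r := by
  classical
  obtain ⟨r0, hr0⟩ := hne
  refine ⟨fun g => if h : ∃ s : Δ, g s = 1 then h.choose.1 else r0, ?_, ?_⟩
  · intro g
    dsimp only
    split_ifs with h
    · exact h.choose.2
    · exact hr0
  · intro r hr
    have h : ∃ s : Δ, encR Δ r s = 1 := ⟨⟨r, hr⟩, by simp [encR]⟩
    dsimp only
    rw [dif_pos h]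
    have h2 : ∀ s : Δ, encR Δ r s = 1 → s.1 = r := by
      intro s h2
      by_contra hc
      simp [encR, hc] at h2
    exact h2 _ h.choose_spec

open Classical in
theorem stage_zero (X : Type) [MetricSpace X] [Finite X] (Δ : Set ℝ) [Finite Δ]
    (hne : Δ.Nonempty) (hX : ∀ x y : X, x ≠ y → dist x y ∈ Δ) : Stage X Δ 0 := by
  obtain ⟨dec, dec1, dec2⟩ := exists_dec Δ hne
  have two : ∀ g : Δ → ZMod 3, 2 • g + 2 • g = g := by
    intro g; funext s
    have : ∀ z : ZMod 3, 2 • z + 2 • z = z := by decide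
    simpa using this (g s)
  let P : PG (X × (X → (Δ → ZMod 3))) :=
    { adj := fun _ _ => True
      d := fun u v => if u = v then 0 else dec (u.2 v.1 + v.2 u.1)
      adj_refl := fun _ => trivial
      adj_symm := fun _ _ _ => trivial
      d_self := fun x => if_pos rfl
      d_symm := fun x y => by
        by_cases h : x = y
        · simp [h]
        · rw [if_neg h, if_neg (Ne.symm h), add_comm] }
  refine ⟨_, inferInstance, P, fun x => (x, fun y => 2 • encR Δ (dist x y)), ⟨?_, ?_, ?_, ?_⟩, ?_⟩
  · intro x y _ hxy
    show (if x = y then 0 else _) ∈ Δ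
    rw [if_neg hxy]
    exact dec1 _
  · intro x y; trivial
  · intro x y
    show (if _ = _ then 0 else _) = _
    by_cases h : x = y
    · subst h; simp
    · rw [if_neg (fun hh => h (congrArg Prod.fst hh))]
      dsimp only
      rw [dist_comm y x, two, dec2 _ (hX x y h)]
  · intro A p hp
    have inj : Set.InjOn p A := by
      intro a ha b hb hab
      rw [← dist_eq_zero, ← hp a ha b hb, hab, dist_self]
    obtain ⟨g, hg⟩ := exists_perm A p inj
    let k : X → X → (Δ → ZMod 3) := fun x y =>
      2 • encR Δ (dist (g x) (g y)) - 2 • encR Δ (dist x y)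
    have ksymm : ∀ x y, k x y = k y x := fun x y => by
      simp only [k, dist_comm]
    have kz : ∀ x ∈ A, ∀ y ∈ A, k x y = 0 := fun x hx y hy => by
      simp only [k]
      rw [hg x hx, hg y hy, hp x hx y hy, sub_self]
    let f : X → X → (Δ → ZMod 3) := fun x y =>
      (if x ∈ A then k x y else 0) - (if y ∈ A then k y x else 0)
    have fanti : ∀ x y, f x y + f y x = 0 := fun x y => by
      simp only [f]; abel
    have fA : ∀ x ∈ A, ∀ y, f x y = k x y := by
      intro x hx y
      simp only [f]
      rw [if_pos hx]
      by_cases hy : y ∈ A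
      · rw [if_pos hy, kz y hy x hx, sub_zero]
      · rw [if_neg hy, sub_zero]
    let j : (X × (X → (Δ → ZMod 3))) ≃ (X × (X → (Δ → ZMod 3))) :=
      { toFun := fun u => (g u.1, fun y => u.2 (g.symm y) + f u.1 (g.symm y))
        invFun := fun u => (g.symm u.1, fun y => u.2 (g y) - f (g.symm u.1) y)
        left_inv := fun u => by simp
        right_inv := fun u => by simp }
    refine ⟨j, fun _ _ => Iff.rfl, ?_, ?_⟩
    · intro x y
      show (if j x = j y then 0 else _) = if x = y then 0 else _
      by_cases h : x = y
      · rw [if_pos h, if_pos (congrArg j h)]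
      · rw [if_neg h, if_neg (fun hh => h (j.injective hh))]
        congr 1
        show x.2 (g.symm (g y.1)) + f x.1 (g.symm (g y.1)) +
          (y.2 (g.symm (g x.1)) + f y.1 (g.symm (g x.1))) = _
        rw [g.symm_apply_apply, g.symm_apply_apply]
        have := fanti x.1 y.1
        calc _ = x.2 y.1 + y.2 x.1 + (f x.1 y.1 + f y.1 x.1) := by abel
          _ = _ := by rw [this, add_zero]
    · intro a ha
      show (g a, fun y => 2 • encR Δ (dist a (g.symm y)) + f a (g.symm y)) = _
      refine Prod.ext (hg a ha) ?_
      funext y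
      dsimp only
      rw [fA a ha]
      simp only [k, g.apply_symm_apply]
      rw [hg a ha]
      abel
  · intro m hm
    omega

/-! ### The inductive step -/

/-- Extend a finite sequence to all naturals. -/
def extW {V : Type} {n : ℕ} (w : Fin (n + 1) → V) : ℕ → V := fun k => w (Fin.ofNat (n + 1) k)

/-- Compatibility of valuation values along the closed walk `w`. -/
def Good {V : Type} (n : ℕ) (w : ℕ → V) (x y : V) (c c' : Bool) : Prop :=
  (∀ i < n, (x = w i ∧ y = w (i + 1)) ∨ (y = w i ∧ x = w (i + 1)) → c = c') ∧
  ((x = w 0 ∧ y = w n) ∨ (y = w 0 ∧ x = w n) → c ≠ c')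

theorem Good.symm {V : Type} {n : ℕ} {w : ℕ → V} {x y : V} {c c' : Bool}
    (h : Good n w x y c c') : Good n w y x c' c :=
  ⟨fun i hi hh => (h.1 i hi hh.symm).symm, fun hh => (h.2 hh.symm).symm⟩

theorem good_map {V : Type} (j : V ≃ V) (n : ℕ) (w : ℕ → V) (x y : V) (c c' b b' : Bool)
    (hb : x ∈ Set.range w → y ∈ Set.range w → b = b') :
    Good n (fun i => j (w i)) (j x) (j y) (c ^^ b) (c' ^^ b') ↔ Good n w x y c c' := by
  by_cases h : x ∈ Set.range w ∧ y ∈ Set.range w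
  · have := hb h.1 h.2
    subst this
    simp [Good]
  · have h' : ∀ i k, ¬ (x = w i ∧ y = w k) := fun i k hh =>
      h ⟨⟨i, hh.1.symm⟩, ⟨k, hh.2.symm⟩⟩
    have h'' : ∀ i k, ¬ (y = w i ∧ x = w k) := fun i k hh => h' k i hh.symm
    simp [Good, h', h'']

def stepPG {V : Type} (P : PG V) (n : ℕ) : PG (V × ((Fin (n + 1) → V) → Bool)) where
  adj := fun u v => u = v ∨ (u.1 ≠ v.1 ∧ P.adj u.1 v.1 ∧
    ∀ w : Fin (n + 1) → V, P.Bad n (extW w) → Good n (extW w) u.1 v.1 (u.2 w) (v.2 w))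
  d := fun u v => P.d u.1 v.1
  adj_refl := fun _ => Or.inl rfl
  adj_symm := fun x y h => by
    rcases h with h | ⟨h1, h2, h3⟩
    · exact Or.inl h.symm
    · exact Or.inr ⟨h1.symm, P.adj_symm _ _ h2, fun w hw => (h3 w hw).symm⟩
  d_self := fun x => P.d_self _
  d_symm := fun x y => P.d_symm _ _

theorem stepPG_adj {V : Type} (P : PG V) (n : ℕ) (u v) (h : (stepPG P n).adj u v) :
    P.adj u.1 v.1 := by
  rcases h with h | h
  · subst h; exact P.adj_refl _
  · exact h.2.1

theorem extW_comp {V : Type} {n : ℕ} (j : V → V) (w : Fin (n + 1) → V) :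
    extW (fun i => j (w i)) = fun i => j (extW w i) := rfl

theorem stepPG_noBad {V : Type} (P : PG V) {Δ : Set ℝ} (hΔ : ∀ r ∈ Δ, 0 < r) (hP : P.Lab Δ)
    (n : ℕ) (v) : ¬ (stepPG P n).Bad n v := by
  intro hb
  have hb' : P.Bad n (fun i => (v i).1) :=
    PG.bad_map (stepPG P n) P Prod.fst v n (stepPG_adj P n) (fun _ _ _ => rfl) hb
  let w : Fin (n + 1) → V := fun i => (v i.1).1
  have hw : ∀ i ≤ n, (v i).1 = extW w i := by
    intro i hi
    simp only [extW, w, Fin.ofNat]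
    rw [Nat.mod_eq_of_lt (by omega)]
  have hbw : P.Bad n (extW w) := P.bad_congr n _ _ hw hb'
  have hne := P.bad_ends hΔ hP n _ hb'
  obtain ⟨h1, h2, h3⟩ := hb
  have hc : ∀ i ≤ n, (v i).2 w = (v 0).2 w := by
    intro i
    induction i with
    | zero => intro _; rfl
    | succ i ih =>
      intro hi
      rw [← ih (by omega)]
      rcases h1 i hi with h | h
      · rw [h]
      · exact ((h.2.2 w hbw).1 i hi (Or.inl ⟨hw i (by omega), hw _ hi⟩)).symm
  rcases h2 with h | h
  · exact hne (congrArg Prod.fst h)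
  · exact (h.2.2 w hbw).2 (Or.inl ⟨hw 0 (by omega), hw n le_rfl⟩) (hc n le_rfl).symm

open Classical in
theorem stage_succ (X : Type) [MetricSpace X] (Δ : Set ℝ) (hΔ : ∀ r ∈ Δ, 0 < r)
    (n : ℕ) (hs : Stage X Δ n) : Stage X Δ (n + 1) := by
  obtain ⟨V, fV, P, e, wit, hno⟩ := hs
  have key := P.key e wit.adj wit.dist n hno
  have einj : ∀ x y, e x = e y → x = y := by
    intro x y h
    rw [← dist_eq_zero, ← wit.dist, h, P.d_self]
  let val : V → (Fin (n + 1) → V) → Bool := fun x w =>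
    decide (P.Bad n (extW w) ∧ x = extW w 0 ∧ extW w n ∈ Set.range e)
  refine ⟨_, inferInstance, stepPG P n, fun x => (e x, val (e x)), ⟨?_, ?_, ?_, ?_⟩, ?_⟩
  · intro u v h huv
    rcases h with h | h
    · exact absurd h huv
    · exact wit.lab _ _ h.2.1 h.1
  · intro x y
    by_cases hxy : x = y
    · subst hxy; exact (stepPG P n).adj_refl _
    · refine Or.inr ⟨fun h => hxy (einj _ _ h), wit.adj _ _, ?_⟩
      intro w hw
      have n2 := P.bad_two n _ hw
      have main : ∀ a b : X, ∀ i < n, e a = extW w i → e b = extW w (i + 1) →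
          ∀ c : X, ¬ (P.Bad n (extW w) ∧ e c = extW w 0 ∧ extW w n ∈ Set.range e) := by
        rintro a b i hi h1 h2 c ⟨_, h3, h4⟩
        by_cases h : i = 0
        · subst h
          exact key _ hw 1 (by omega) (by omega) ⟨c, h3⟩ ⟨b, h2⟩ h4
        · exact key _ hw i (by omega) (by omega) ⟨c, h3⟩ ⟨a, h1⟩ h4
      have ends := P.bad_ends hΔ wit.lab n _ hw
      refine ⟨?_, ?_⟩
      · intro i hi h
        have : ∀ c : X, ¬ (P.Bad n (extW w) ∧ e c = extW w 0 ∧ extW w n ∈ Set.range e) := by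
          rcases h with h | h
          · exact main x y i hi h.1 h.2
          · exact main y x i hi h.1 h.2
        simp only [val]
        rw [decide_eq_false (this x), decide_eq_false (this y)]
      · intro h
        simp only [val]
        rcases h with ⟨h1, h2⟩ | ⟨h1, h2⟩
        · rw [decide_eq_true ⟨hw, h1, ⟨y, h2⟩⟩, decide_eq_false (fun hh => ends (hh.2.1.symm.trans h2))]
          decide
        · rw [decide_eq_true (p := _ ∧ e y = _ ∧ _) ⟨hw, h1, ⟨x, h2⟩⟩,
            decide_eq_false (fun hh => ends (hh.2.1.symm.trans h2))]
          decide
  · intro x y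
    exact wit.dist x y
  · intro A p hp
    obtain ⟨j, j1, j2, j3⟩ := wit.ext A p hp
    have badj : ∀ w : Fin (n + 1) → V,
        P.Bad n (extW (fun i => j (w i))) ↔ P.Bad n (extW w) := by
      intro w
      constructor
      · intro h
        have := P.bad_map P j.symm _ n
          (fun x y h => by rw [← j1]; simpa using h)
          (fun x y h => by rw [← j2]; simp) h
        refine P.bad_congr n _ _ ?_ this
        intro i _
        simp [extW]
      · intro h
        exact P.bad_map P j _ n (fun x y h => (j1 x y).2 h) (fun x y h => j2 x y) h
    let F : (Fin (n + 1) → V) → Bool := fun w =>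
      decide (extW w 0 ∈ e '' A ∧ P.Bad n (extW w)) &&
        (decide (extW w n ∈ Set.range e) ^^ decide (j (extW w n) ∈ Set.range e))
    let f : V → (Fin (n + 1) → V) → Bool := fun x w =>
      decide (x ∈ Set.range (extW w)) && F w
    have hval : ∀ a ∈ A, ∀ w : Fin (n + 1) → V,
        val (j (e a)) (fun i => j (w i)) = (val (e a) w ^^ f (e a) w) := by
      intro a ha w
      by_cases hb : P.Bad n (extW w)
      · have hb2 := (badj w).2 hb
        by_cases hx : e a = extW w 0
        · have e1 : val (j (e a)) (fun i => j (w i)) = decide (j (extW w n) ∈ Set.range e) := by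
            rw [extW_comp] at hb2
            simp only [val, extW_comp]
            refine decide_eq_decide.2 ?_
            exact ⟨fun h => h.2.2, fun h => ⟨hb2, congrArg j hx, h⟩⟩
          have e2 : val (e a) w = decide (extW w n ∈ Set.range e) := by
            simp only [val, decide_eq_decide]
            exact ⟨fun h => h.2.2, fun h => ⟨hb, hx, h⟩⟩
          have e3 : f (e a) w =
              (decide (extW w n ∈ Set.range e) ^^ decide (j (extW w n) ∈ Set.range e)) := by
            simp only [f, F]
            rw [decide_eq_true (p := e a ∈ Set.range (extW w)) ⟨0, hx.symm⟩,
              decide_eq_true (p := _ ∧ _) ⟨⟨a, ha, hx⟩, hb⟩, Bool.true_and, Bool.true_and]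
          rw [e1, e2, e3]
          simp
        · have e1 : val (j (e a)) (fun i => j (w i)) = false := by
            simp only [val, extW_comp]
            exact decide_eq_false (fun h => hx (j.injective h.2.1))
          have e2 : val (e a) w = false := by
            simp only [val]
            exact decide_eq_false (fun h => hx h.2.1)
          have e3 : f (e a) w = false := by
            by_cases hr : e a ∈ Set.range (extW w)
            swap
            · simp only [f]
              rw [decide_eq_false hr, Bool.false_and]
            by_cases h0 : extW w 0 ∈ e '' A
            swap
            · simp only [f, F]
              rw [decide_eq_false (p := _ ∧ _) (fun h => h0 h.1), Bool.false_and, Bool.and_false]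
            have hr' : ∃ i ≤ n, extW w i = e a := by
              obtain ⟨i, hi⟩ := hr
              refine ⟨i % (n + 1), Nat.le_of_lt_succ (Nat.mod_lt _ (Nat.succ_pos _)), ?_⟩
              rw [← hi]
              simp [extW, Fin.ofNat]
            obtain ⟨i, hi, hia⟩ := hr'
            have hi0 : i ≠ 0 := by
              rintro rfl
              exact hx hia.symm
            have e4 : decide (extW w n ∈ Set.range e) =
                decide (j (extW w n) ∈ Set.range e) := by
              obtain ⟨b, hbA, hb0⟩ := h0
              by_cases hin : i = n
              · subst hin
                rw [hia, decide_eq_true ⟨a, rfl⟩, j3 a ha, decide_eq_true ⟨p a, rfl⟩]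
              · rw [decide_eq_false, decide_eq_false]
                · intro h
                  refine key _ hb2 i (by omega) (by omega) ⟨p b, ?_⟩ ⟨p a, ?_⟩ h
                  · rw [← j3 b hbA, hb0]; rfl
                  · rw [← j3 a ha, ← hia]; rfl
                · intro h
                  exact key _ hb i (by omega) (by omega) ⟨b, hb0⟩ ⟨a, hia.symm⟩ h
            simp only [f, F]
            rw [e4, Bool.xor_self, Bool.and_false, Bool.and_false]
          rw [e1, e2, e3]
          rfl
      · have hb2 := fun h => hb ((badj w).1 h)
        simp only [val, f, F]
        rw [decide_eq_false (fun h => hb2 h.1), decide_eq_false (fun h => hb h.1),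
          decide_eq_false (p := _ ∧ P.Bad n (extW w)) (fun h => hb h.2)]
        simp
    let θ : (V × ((Fin (n + 1) → V) → Bool)) ≃ (V × ((Fin (n + 1) → V) → Bool)) :=
      { toFun := fun u => (j u.1, fun w =>
          u.2 (fun i => j.symm (w i)) ^^ f u.1 (fun i => j.symm (w i)))
        invFun := fun u => (j.symm u.1, fun w =>
          u.2 (fun i => j (w i)) ^^ f (j.symm u.1) w)
        left_inv := fun u => by simp
        right_inv := fun u => by simp }
    refine ⟨θ, ?_, fun x y => j2 _ _, ?_⟩
    · intro u v
      refine or_congr θ.injective.eq_iff (and_congr (not_congr j.injective.eq_iff)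
        (and_congr (j1 _ _) ?_))
      have gm : ∀ w : Fin (n + 1) → V,
          (P.Bad n (extW (fun i => j (w i))) → Good n (extW (fun i => j (w i))) (j u.1) (j v.1)
            ((θ u).2 (fun i => j (w i))) ((θ v).2 (fun i => j (w i)))) ↔
          (P.Bad n (extW w) → Good n (extW w) u.1 v.1 (u.2 w) (v.2 w)) := by
        intro w
        refine imp_congr (badj w) ?_
        have t : ∀ u, (θ u).2 (fun i => j (w i)) = (u.2 w ^^ f u.1 w) := by
          intro u
          simp [θ]
        rw [t, t]
        refine good_map j n (extW w) _ _ _ _ _ _ ?_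
        intro h1 h2
        simp only [f]
        rw [decide_eq_true h1, decide_eq_true h2]
      constructor
      · intro h w
        exact (gm w).1 (h _)
      · intro h w
        have := (gm (fun i => j.symm (w i))).2 (h _)
        simp only [Equiv.apply_symm_apply] at this
        exact this
    · intro a ha
      refine Prod.ext (j3 a ha) ?_
      funext w
      have := hval a ha (fun i => j.symm (w i))
      simp only [Equiv.apply_symm_apply] at this
      show (val (e a) (fun i => j.symm (w i)) ^^ f (e a) (fun i => j.symm (w i))) = val (e (p a)) w
      rw [← this, j3 a ha]
  · intro m hm v hb
    by_cases h : m = n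
    · subst h
      exact stepPG_noBad P hΔ wit.lab m v hb
    · exact hno m (by omega) _ (PG.bad_map (stepPG P n) P Prod.fst v m (stepPG_adj P n) (fun _ _ _ => rfl) hb)

/-! ### The path metric -/

/-- Walks along proper edges, with number of steps and total length. -/
inductive PG.Reach {V : Type} (P : PG V) : V → V → ℕ → ℝ → Prop
  | nil (x : V) : PG.Reach P x x 0 0
  | cons (x y z : V) (k : ℕ) (r : ℝ) : P.adj x y → x ≠ y → PG.Reach P y z k r →
      PG.Reach P x z (k + 1) (P.d x y + r)

theorem PG.Reach.append {V : Type} {P : PG V} {x y z : V} {k l : ℕ} {r s : ℝ}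
    (h : P.Reach x y k r) (h' : P.Reach y z l s) : P.Reach x z (k + l) (r + s) := by
  induction h with
  | nil x => simpa using h'
  | cons x y _ k r ha hne _ ih =>
    have := PG.Reach.cons x y z _ _ ha hne (ih h')
    rw [add_assoc (P.d x y), show k + 1 + l = k + l + 1 by omega]
    exact this

theorem PG.Reach.single {V : Type} {P : PG V} {x y : V} (h : P.adj x y) (hne : x ≠ y) :
    P.Reach x y 1 (P.d x y) := by
  have := PG.Reach.cons x y y 0 0 h hne (PG.Reach.nil y)
  simpa using this

theorem PG.Reach.reverse {V : Type} {P : PG V} {x y : V} {k : ℕ} {r : ℝ}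
    (h : P.Reach x y k r) : P.Reach y x k r := by
  induction h with
  | nil x => exact PG.Reach.nil x
  | cons x y z k r ha hne _ ih =>
    have := ih.append (PG.Reach.single (P.adj_symm _ _ ha) hne.symm)
    rwa [P.d_symm y x, add_comm r] at this

theorem PG.Reach.map {V : Type} {P : PG V} (j : V ≃ V) (j1 : ∀ x y, P.adj (j x) (j y) ↔ P.adj x y)
    (j2 : ∀ x y, P.d (j x) (j y) = P.d x y) {x y : V} {k : ℕ} {r : ℝ}
    (h : P.Reach x y k r) : P.Reach (j x) (j y) k r := by
  induction h with
  | nil x => exact PG.Reach.nil _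
  | cons x y z k r ha hne _ ih =>
    rw [← j2 x y]
    exact PG.Reach.cons _ _ _ _ _ ((j1 _ _).2 ha) (fun h => hne (j.injective h)) ih

theorem PG.Reach.walk {V : Type} {P : PG V} {x y : V} {k : ℕ} {r : ℝ}
    (h : P.Reach x y k r) : ∃ v : ℕ → V, v 0 = x ∧ v k = y ∧ (∀ i < k, P.adj (v i) (v (i + 1))) ∧
      ∑ i ∈ Finset.range k, P.d (v i) (v (i + 1)) = r := by
  induction h with
  | nil x => exact ⟨fun _ => x, rfl, rfl, fun i hi => absurd hi (by omega), by simp⟩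
  | cons x y z k r ha hne _ ih =>
    obtain ⟨v, v0, vk, va, vs⟩ := ih
    refine ⟨fun i => Nat.casesOn i x v, rfl, vk, ?_, ?_⟩
    · intro i hi
      cases i with
      | zero => rw [← v0] at ha; exact ha
      | succ i => exact va i (by omega)
    · rw [Finset.sum_range_succ']
      rw [add_comm]
      refine congrArg₂ _ ?_ vs
      show P.d x (v 0) = P.d x y
      rw [v0]

theorem PG.Reach.mem_closure {V : Type} {P : PG V} {Δ : Set ℝ} (hP : P.Lab Δ) {x y : V} {k : ℕ}
    {r : ℝ} (h : P.Reach x y k r) : r ∈ AddSubmonoid.closure Δ := by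
  induction h with
  | nil x => exact zero_mem _
  | cons x y z k r ha hne _ ih =>
    exact add_mem (AddSubmonoid.subset_closure (hP _ _ ha hne)) ih

theorem PG.Reach.lower {V : Type} {P : PG V} {Δ : Set ℝ} (hP : P.Lab Δ) {δ : ℝ}
    (hδ : ∀ s ∈ Δ, δ ≤ s) {x y : V} {k : ℕ}
    {r : ℝ} (h : P.Reach x y k r) : k * δ ≤ r := by
  induction h with
  | nil x => simp
  | cons x y z k r ha hne _ ih =>
    have := hδ _ (hP _ _ ha hne)
    push_cast
    linarith

theorem PG.Reach.pos {V : Type} {P : PG V} {x y : V} {k : ℕ}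
    {r : ℝ} (h : P.Reach x y k r) (hne : x ≠ y) : 1 ≤ k := by
  cases h with
  | nil => exact absurd rfl hne
  | cons => omega

theorem stage_all (X : Type) [MetricSpace X] [Finite X] (Δ : Set ℝ) [Finite Δ]
    (hΔ : ∀ r ∈ Δ, 0 < r)
    (hne : Δ.Nonempty) (hX : ∀ x y : X, x ≠ y → dist x y ∈ Δ) (n : ℕ) : Stage X Δ n := by
  induction n with
  | zero => exact stage_zero X Δ hne hX
  | succ n ih => exact stage_succ X Δ hΔ n ih

theorem hsv_aux (X : Type) [MetricSpace X] [Finite X] (Δ : Set ℝ) [Finite Δ]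
    (hΔ : ∀ r ∈ Δ, 0 < r) (hX : ∀ x y : X, x ≠ y → dist x y ∈ Δ)
    (D : ℝ) (hD : D ∈ Δ) (hmax : ∀ r ∈ Δ, r ≤ D) :
    ∃ (Z : Type) (_ : MetricSpace Z) (_ : Finite Z),
      (∀ z w : Z, dist z w ≤ D ∧ dist z w ∈ AddSubmonoid.closure Δ) ∧
      ∃ e : X → Z,
        Isometry e ∧
        ∀ (A : Set X) (p : X → X),
          (∀ a ∈ A, ∀ b ∈ A, dist (p a) (p b) = dist a b) →
          ∃ j : Z ≃ᵢ Z, ∀ a ∈ A, j (e a) = e (p a) := by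
  have hfin : Δ.Finite := Set.toFinite Δ
  obtain ⟨δ, hδΔ, hδ⟩ := Set.exists_min_image Δ id hfin ⟨D, hD⟩
  simp only [id] at hδ
  have δpos := hΔ δ hδΔ
  obtain ⟨N, hN⟩ := exists_nat_ge (D / δ)
  rw [div_le_iff₀ δpos] at hN
  obtain ⟨V, fV, P, e, wit, hno⟩ := stage_all X Δ hΔ ⟨D, hD⟩ hX N
  let R : V → V → Set ℝ := fun x y => {r | r = D ∨ ∃ k, P.Reach x y k r}
  have RD : ∀ x y, D ∈ R x y := fun x y => Or.inl rfl
  have Rsub : ∀ x y, R x y ⊆ AddSubmonoid.closure Δ := by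
    rintro x y r (rfl | ⟨k, h⟩)
    · exact AddSubmonoid.subset_closure hD
    · exact h.mem_closure wit.lab
  have wf : ∀ x y, (R x y).IsWF := fun x y =>
    ((Set.IsPWO.addSubmonoid_closure (fun r hr => (hΔ r hr).le) hfin.isPWO).mono (Rsub x y)).isWF
  have least : ∀ x y, ∃ m, IsLeast (R x y) m := fun x y =>
    ⟨(wf x y).min ⟨D, RD x y⟩, (wf x y).min_mem _, fun r hr => (wf x y).min_le _ hr⟩
  choose ρ hρ using least
  have Rnn : ∀ x y, ∀ r ∈ R x y, 0 ≤ r := by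
    rintro x y r (rfl | ⟨k, h⟩)
    · exact (hΔ _ hD).le
    · exact le_trans (by positivity) (h.lower wit.lab hδ)
  have Rpos : ∀ x y, x ≠ y → ∀ r ∈ R x y, 0 < r := by
    rintro x y hxy r (rfl | ⟨k, h⟩)
    · exact hΔ _ hD
    · have h1 := h.pos hxy
      refine lt_of_lt_of_le ?_ (h.lower wit.lab hδ)
      have : (0 : ℝ) < k := by exact_mod_cast h1
      positivity
  have ρself : ∀ x, ρ x x = 0 := fun x =>
    le_antisymm ((hρ x x).2 (Or.inr ⟨0, PG.Reach.nil x⟩)) (Rnn _ _ _ (hρ x x).1)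
  have Rsymm : ∀ x y, R x y = R y x := by
    intro x y
    ext r
    exact or_congr Iff.rfl ⟨fun ⟨k, h⟩ => ⟨k, h.reverse⟩, fun ⟨k, h⟩ => ⟨k, h.reverse⟩⟩
  have ρcongr : ∀ x y x' y', R x y = R x' y' → ρ x y = ρ x' y' := by
    intro x y x' y' h
    have h1 := hρ x y
    rw [h] at h1
    exact h1.unique (hρ x' y')
  have ρtri : ∀ x y z, ρ x z ≤ ρ x y + ρ y z := by
    intro x y z
    have n1 := Rnn _ _ _ (hρ x y).1
    have n2 := Rnn _ _ _ (hρ y z).1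
    have hD' := (hρ x z).2 (RD x z)
    rcases (hρ x y).1 with h | ⟨k, h⟩
    · linarith
    rcases (hρ y z).1 with h' | ⟨l, h'⟩
    · linarith
    exact (hρ x z).2 (Or.inr ⟨_, h.append h'⟩)
  let M : MetricSpace V :=
    { dist := ρ
      dist_self := ρself
      dist_comm := fun x y => ρcongr _ _ _ _ (Rsymm x y)
      dist_triangle := ρtri
      eq_of_dist_eq_zero := fun {x y} h => by
        by_contra hxy
        exact (Rpos x y hxy _ (hρ x y).1).ne' h }
  refine ⟨V, M, fV, fun z w => ⟨(hρ z w).2 (RD z w), Rsub _ _ (hρ z w).1⟩, e, ?_, ?_⟩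
  · refine Isometry.of_dist_eq fun x y => ?_
    show ρ (e x) (e y) = dist x y
    by_cases hxy : x = y
    · subst hxy; rw [ρself, dist_self]
    have hne : e x ≠ e y := by
      intro h
      apply hxy
      rw [← dist_eq_zero, ← wit.dist, h, P.d_self]
    have hle : dist x y ≤ D := hmax _ (hX x y hxy)
    refine (hρ _ _).unique ⟨Or.inr ⟨1, ?_⟩, ?_⟩
    · rw [← wit.dist]
      exact PG.Reach.single (wit.adj x y) hne
    · rintro r (rfl | ⟨k, h⟩)
      · exact hle
      · by_cases hk : k < N
        · obtain ⟨v, v0, vk, va, vs⟩ := h.walk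
          by_contra hc
          refine hno k hk v ⟨va, ?_, ?_⟩
          · rw [v0, vk]; exact wit.adj _ _
          · rw [v0, vk, vs, wit.dist]; exact not_le.1 hc
        · have h1 := h.lower wit.lab hδ
          have h2 : (N : ℝ) ≤ k := by exact_mod_cast not_lt.1 hk
          have h3 := mul_le_mul_of_nonneg_right h2 δpos.le
          linarith
  · intro A p hp
    obtain ⟨j, j1, j2, j3⟩ := wit.ext A p hp
    refine ⟨⟨j, Isometry.of_dist_eq fun x y => ?_⟩, j3⟩
    refine ρcongr _ _ _ _ ?_
    ext r
    refine or_congr Iff.rfl ⟨fun ⟨k, h⟩ => ⟨k, ?_⟩, fun ⟨k, h⟩ => ⟨k, h.map j j1 j2⟩⟩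
    have := h.map j.symm (fun x y => by rw [← j1]; simp) (fun x y => by rw [← j2]; simp)
    simpa using this

/-- **General form of the Hrushovski–Solecki–Vershik theorem.** Let `T ⊆ ℝ` be closed
under addition and let `S ⊆ T` contain `0` and be convex in `T`. Then every finite metric
space with distances in `S` embeds isometrically into a finite metric space with distances
in `S` in which every partial isometry of the original space extends to a global
self-isometry. -/
theorem hrushovski_solecki_vershik_general (T S : Set ℝ)
    (hT : ∀ x ∈ T, ∀ y ∈ T, x + y ∈ T)
    (hST : S ⊆ T) (h0S : (0 : ℝ) ∈ S)
    (hconv : ∀ x ∈ S, ∀ z ∈ S, ∀ y ∈ T, x ≤ y → y ≤ z → y ∈ S)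
    (X : Type) [MetricSpace X] [Finite X]
    (hX : ∀ x y : X, dist x y ∈ S) :
    ∃ (Z : Type) (_ : MetricSpace Z) (_ : Finite Z),
      (∀ z w : Z, dist z w ∈ S) ∧
      ∃ e : X → Z,
        Isometry e ∧
        ∀ (A : Set X) (p : X → X),
          (∀ a ∈ A, ∀ b ∈ A, dist (p a) (p b) = dist a b) →
          ∃ j : Z ≃ᵢ Z, ∀ a ∈ A, j (e a) = e (p a) := by
  rcases subsingleton_or_nontrivial X with hs | hs
  · refine ⟨X, inferInstance, inferInstance, hX, id, isometry_id, fun A p _ => ?_⟩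
    exact ⟨IsometryEquiv.refl X, fun a _ => Subsingleton.elim _ _⟩
  · let Δ : Set ℝ := (fun q : X × X => dist q.1 q.2) '' {q | q.1 ≠ q.2}
    have fΔ : Δ.Finite := (Set.toFinite _).image _
    have : Finite Δ := fΔ
    have hΔ : ∀ r ∈ Δ, 0 < r := by
      rintro r ⟨q, hq, rfl⟩
      exact dist_pos.2 hq
    have hΔS : Δ ⊆ S := by
      rintro r ⟨q, hq, rfl⟩
      exact hX _ _
    have hXΔ : ∀ x y : X, x ≠ y → dist x y ∈ Δ := fun x y h => ⟨(x, y), h, rfl⟩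
    obtain ⟨a, b, hab⟩ := exists_pair_ne X
    obtain ⟨D, hD, hmax⟩ := Set.exists_max_image Δ id fΔ ⟨_, hXΔ a b hab⟩
    obtain ⟨Z, M, fZ, hZ, h⟩ := hsv_aux X Δ hΔ hXΔ D hD hmax
    refine ⟨Z, M, fZ, fun z w => ?_, h⟩
    refine hconv 0 h0S D (hΔS hD) _ ?_ dist_nonneg (hZ z w).1
    have key : ∀ r ∈ AddSubmonoid.closure Δ, r ∈ T := by
      intro r hr
      induction hr using AddSubmonoid.closure_induction with
      | mem x hx => exact hST (hΔS hx)
      | zero => exact hST h0S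
      | add x y _ _ hx hy => exact hT x hx y hy
    exact key _ (hZ z w).2
end
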